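/- For every integer R ≥ 2, the asymptotic worst-case density ν*(R) of normal symmetric binary covering codes of radius R satisfies ν*(R) ≤ e·(R·log R + log R + log log R + 4), given that ν*(1) = 1. -/

import Mathlib

open Finset

abbrev Vec (n : ℕ) := Fin n → Bool

noncomputable def dS {n : ℕ} (x : Vec n) (Y : Set (Vec n)) : ℕ∞ :=
  ⨅ y ∈ Y, (hammingDist x y : ℕ∞)

noncomputable def dA {n : ℕ} (x : Vec n) (Y : Set (Vec n)) : ℕ∞ :=
  ⨅ y ∈ {y ∈ Y | ∀ i, x i ≤ y i}, (hammingDist x y : ℕ∞)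

def sec {n : ℕ} (C : Set (Vec n)) (i : Fin n) (b : Bool) : Set (Vec n) :=
  {c ∈ C | c i = b}

def NormAt {n : ℕ} (C : Set (Vec n)) (i : Fin n) (N : ℕ) : Prop :=
  ∀ x : Vec n, dS x (sec C i false) + dS x (sec C i true) ≤ (N : ℕ∞)

def AsymNormAt {n : ℕ} (C : Set (Vec n)) (i : Fin n) (N : ℕ) : Prop :=
  ∀ x : Vec n,
    (x i = false → dA x (sec C i false) + dA x (sec C i true) ≤ (N : ℕ∞)) ∧
    (x i = true → 2 * dA x (sec C i true) + 1 ≤ (N : ℕ∞))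

def ads {nA nB : ℕ} (A : Set (Vec (nA+1))) (B : Set (Vec (nB+1))) :
    Set (Vec (nA+1+nB)) :=
  {z | ∃ (a : Fin nA → Bool) (t : Bool) (b : Fin nB → Bool),
    Fin.snoc a t ∈ A ∧ Fin.cons t b ∈ B ∧ z = Fin.append (Fin.snoc a t) b}

def flipCoord {n : ℕ} (x : Vec n) (i : Fin n) : Vec n := Function.update x i (!x i)

def PatchedAt {n : ℕ} (S T : Set (Vec n)) (i : Fin n) (N : ℕ) : Prop :=
  ∀ x : Vec n, (dS x (sec S i false) + dS x (sec S i true) ≤ (N : ℕ∞))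
    ∨ (x ∈ T ∧ flipCoord x i ∈ T)

def AsymPatchedAt {n : ℕ} (S T : Set (Vec n)) (i : Fin n) (N : ℕ) : Prop :=
  ∀ x : Vec n,
    (x i = false → (dA x (sec S i false) + dA x (sec S i true) ≤ (N : ℕ∞))
       ∨ (x ∈ T ∧ flipCoord x i ∈ T)) ∧
    (x i = true → (2 * dA x (sec S i true) + 1 ≤ (N : ℕ∞)) ∨ x ∈ T)

/-- `C` is a normal symmetric covering code of length `n` and radius `R`:
it covers the cube within radius `R`, and some coordinate is acceptable
with respect to `2R+1`. -/
def IsNormalCode (n R : ℕ) (C : Finset (Vec n)) : Prop :=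
  (∀ x : Vec n, ∃ c ∈ C, hammingDist x c ≤ R) ∧
  ∃ i : Fin n, ∀ x : Vec n,
    dS x (sec (↑C) i false) + dS x (sec (↑C) i true) ≤ ((2 * R + 1 : ℕ) : ℕ∞)

/-- `K_ν(n,R)`: minimum size of a normal `(n,R)`-code. -/
noncomputable def Knu (n R : ℕ) : ℕ :=
  sInf {k : ℕ | ∃ C : Finset (Vec n), C.card = k ∧ IsNormalCode n R C}

/-- Optimal density `ν(n,R)` of a normal `(n,R)`-code. -/
noncomputable def nuDen (n R : ℕ) : ℝ :=
  (Knu n R : ℝ) * (∑ i ∈ Finset.range (R + 1), (n.choose i : ℝ)) / 2 ^ n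

/-- Asymptotic worst-case density `ν*(R)` of normal `(n,R)`-codes. -/
noncomputable def nuStar (R : ℕ) : ℝ :=
  Filter.limsup (fun n : ℕ => nuDen n R) Filter.atTop

theorem exists_dist_eq_dS {n : ℕ} {x : Vec n} {Y : Set (Vec n)} (h : dS x Y ≠ ⊤) :
    ∃ y ∈ Y, dS x Y = (hammingDist x y : ℕ∞) := by
  have hne : Nonempty Y := by
    by_contra hY
    rw [Set.nonempty_coe_sort, Set.not_nonempty_iff_eq_empty] at hY
    exact h (by simp [dS, hY])
  obtain ⟨y, hy⟩ := ENat.exists_eq_iInf (fun y : Y => (hammingDist x y : ℕ∞))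
  refine ⟨y, y.2, ?_⟩
  rw [hy, dS, iInf_subtype']

theorem dS_le {n : ℕ} {x y : Vec n} {Y : Set (Vec n)} (hy : y ∈ Y) :
    dS x Y ≤ (hammingDist x y : ℕ∞) :=
  iInf₂_le y hy

theorem isNormalCode_iff {n R : ℕ} {C : Finset (Vec n)} :
    IsNormalCode n R C ↔ ∃ i : Fin n, ∀ x : Vec n, ∃ c ∈ C, ∃ d ∈ C,
      c i = false ∧ d i = true ∧ hammingDist x c + hammingDist x d ≤ 2 * R + 1 := by
  constructor
  · rintro ⟨-, i, hi⟩
    refine ⟨i, fun x => ?_⟩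
    have hfin := ne_top_of_le_ne_top (ENat.natCast_ne_top _) (hi x)
    rw [Ne, ENat.add_eq_top, not_or] at hfin
    obtain ⟨c, hc, hcd⟩ := exists_dist_eq_dS hfin.1
    obtain ⟨d, hd, hdd⟩ := exists_dist_eq_dS hfin.2
    refine ⟨c, hc.1, d, hd.1, hc.2, hd.2, ?_⟩
    have := hi x
    rw [hcd, hdd] at this
    exact_mod_cast this
  · rintro ⟨i, hi⟩
    refine ⟨fun x => ?_, i, fun x => ?_⟩
    · obtain ⟨c, hc, d, hd, -, -, h⟩ := hi x
      by_cases hcR : hammingDist x c ≤ R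
      · exact ⟨c, hc, hcR⟩
      · exact ⟨d, hd, by omega⟩
    · obtain ⟨c, hc, d, hd, hci, hdi, h⟩ := hi x
      calc _ ≤ (hammingDist x c : ℕ∞) + (hammingDist x d : ℕ∞) :=
            add_le_add (dS_le (show c ∈ sec (C : Set (Vec n)) i false from ⟨hc, hci⟩))
              (dS_le (show d ∈ sec (C : Set (Vec n)) i true from ⟨hd, hdi⟩))
        _ ≤ _ := by exact_mod_cast h

theorem hammingDist_append {m l : ℕ} (u u' : Vec m) (v v' : Vec l) :
    hammingDist (Fin.append u v : Vec (m + l)) (Fin.append u' v') =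
      hammingDist u u' + hammingDist v v' := by
  simp only [hammingDist, Finset.card_filter, Fin.sum_univ_add, Fin.append_left,
    Fin.append_right]

theorem hammingDist_update_le_one {n : ℕ} (x : Vec n) (i : Fin n) (b : Bool) :
    hammingDist x (Function.update x i b) ≤ 1 := by
  unfold hammingDist
  refine (Finset.card_le_card (t := {i}) fun j hj => ?_).trans (by simp)
  by_contra hji
  simp_all [Function.update_of_ne]

theorem exists_normalCode {n : ℕ} (hn : 0 < n) (R : ℕ) :
    ∃ C : Finset (Vec n), C.card = Knu n R ∧ IsNormalCode n R C := by
  refine Nat.sInf_mem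
    (s := {k : ℕ | ∃ C : Finset (Vec n), C.card = k ∧ IsNormalCode n R C})
    ⟨_, Finset.univ, rfl, isNormalCode_iff.2 ⟨⟨0, hn⟩, fun x => ?_⟩⟩
  refine ⟨Function.update x ⟨0, hn⟩ false, by simp, Function.update x ⟨0, hn⟩ true, by simp,
    by simp, by simp, ?_⟩
  rcases hx : x ⟨0, hn⟩
  · have h0 : Function.update x ⟨0, hn⟩ false = x := by rw [← hx, Function.update_eq_self]
    have := hammingDist_update_le_one x ⟨0, hn⟩ true
    rw [h0, hammingDist_self]
    omega
  · have h0 : Function.update x ⟨0, hn⟩ true = x := by rw [← hx, Function.update_eq_self]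
    have := hammingDist_update_le_one x ⟨0, hn⟩ false
    rw [h0, hammingDist_self]
    omega

theorem Knu_le {n R : ℕ} {C : Finset (Vec n)} (hC : IsNormalCode n R C) : Knu n R ≤ C.card :=
  Nat.sInf_le ⟨C, rfl, hC⟩

/-- The direct sum of two codes. -/
def codeProd {m l : ℕ} (A : Finset (Vec m)) (B : Finset (Vec l)) : Finset (Vec (m + l)) :=
  (A ×ˢ B).image fun p => Fin.append p.1 p.2

theorem card_codeProd_le {m l : ℕ} (A : Finset (Vec m)) (B : Finset (Vec l)) :
    (codeProd A B).card ≤ A.card * B.card :=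
  Finset.card_image_le.trans_eq (Finset.card_product A B)

theorem append_mem_codeProd {m l : ℕ} {A : Finset (Vec m)} {B : Finset (Vec l)} {a : Vec m}
    {b : Vec l} (ha : a ∈ A) (hb : b ∈ B) : Fin.append a b ∈ codeProd A B :=
  Finset.mem_image.2 ⟨(a, b), by simp [ha, hb], rfl⟩

theorem Knu_add_le_mul {a b : ℕ} (ha : 0 < a) (hb : 0 < b) (R S : ℕ) :
    Knu (a + b) (R + S) ≤ Knu a R * Knu b S := by
  obtain ⟨A, hAcard, hA⟩ := exists_normalCode ha R
  obtain ⟨B, hBcard, hB, -⟩ := exists_normalCode hb S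
  rw [← hAcard, ← hBcard]
  refine le_trans (Knu_le ?_) (card_codeProd_le A B)
  obtain ⟨i, hi⟩ := isNormalCode_iff.1 hA
  refine isNormalCode_iff.2 ⟨Fin.castAdd b i, fun x => ?_⟩
  obtain ⟨u, v, rfl⟩ : ∃ (u : Vec a) (v : Vec b), x = Fin.append u v :=
    ⟨_, _, (Fin.append_castAdd_natAdd (f := x)).symm⟩
  obtain ⟨c, hc, d, hd, hci, hdi, h⟩ := hi u
  obtain ⟨y, hy, hvy⟩ := hB v
  refine ⟨_, append_mem_codeProd hc hy, _, append_mem_codeProd hd hy, ?_, ?_, ?_⟩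
  · simpa using hci
  · simpa using hdi
  · rw [hammingDist_append, hammingDist_append]
    omega

theorem Knu_add_le_of_patch {m l : ℕ} (hl : 0 < l) (R : ℕ) (S T : Finset (Vec m))
    (hST : ∀ u, u ∈ T ∨ ∃ s ∈ S, hammingDist u s ≤ R) :
    Knu (m + l) R ≤ S.card * 2 ^ l + T.card * Knu l R := by
  obtain ⟨B, hBcard, hB⟩ := exists_normalCode hl R
  obtain ⟨i, hi⟩ := isNormalCode_iff.1 hB
  have hcard : (codeProd S Finset.univ ∪ codeProd T B).card ≤
      S.card * 2 ^ l + T.card * Knu l R := by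
    refine (Finset.card_union_le _ _).trans (add_le_add ?_ ?_)
    · simpa using card_codeProd_le S (Finset.univ : Finset (Vec l))
    · simpa [hBcard] using card_codeProd_le T B
  refine le_trans (Knu_le (isNormalCode_iff.2 ⟨Fin.natAdd m i, fun x => ?_⟩)) hcard
  obtain ⟨u, v, rfl⟩ : ∃ (u : Vec m) (v : Vec l), x = Fin.append u v :=
    ⟨_, _, (Fin.append_castAdd_natAdd (f := x)).symm⟩
  rcases hST u with hu | ⟨s, hs, hus⟩
  · obtain ⟨c, hc, d, hd, hci, hdi, h⟩ := hi v
    refine ⟨_, Finset.mem_union_right _ (append_mem_codeProd hu hc),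
      _, Finset.mem_union_right _ (append_mem_codeProd hu hd), ?_, ?_, ?_⟩
    · simpa using hci
    · simpa using hdi
    · simpa [hammingDist_append] using h
  · refine ⟨_, Finset.mem_union_left _
        (append_mem_codeProd hs (Finset.mem_univ (Function.update v i false))),
      _, Finset.mem_union_left _
        (append_mem_codeProd hs (Finset.mem_univ (Function.update v i true))), ?_, ?_, ?_⟩
    · simp
    · simp
    · rw [hammingDist_append, hammingDist_append]
      have hself : Function.update v i (v i) = v := Function.update_eq_self i v
      have h0 := hammingDist_update_le_one v i false
      have h1 := hammingDist_update_le_one v i true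
      rcases hx : v i <;> rw [hx] at hself <;> rw [hself, hammingDist_self] <;> omega

/-- The volume of a Hamming ball of radius `R` in the `n`-dimensional binary cube. -/
def ballVol (R n : ℕ) : ℕ := ∑ i ∈ Finset.range (R + 1), n.choose i

theorem card_hammingBall {n : ℕ} (R : ℕ) (x : Vec n) :
    (Finset.univ.filter fun y : Vec n => hammingDist x y ≤ R).card = ballVol R n := by
  have hsub : ballVol R n =
      (Finset.univ.filter fun s : Finset (Fin n) => s.card ≤ R).card := by
    rw [ballVol, Finset.card_eq_sum_card_fiberwise
      (f := Finset.card) (t := Finset.range (R + 1)) (fun s hs => by simp_all)]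
    refine Finset.sum_congr rfl fun i hi => ?_
    rw [Finset.mem_range] at hi
    have : (Finset.univ.filter fun s : Finset (Fin n) => s.card ≤ R).filter (fun s => s.card = i)
        = Finset.powersetCard i Finset.univ := by
      ext s
      simp only [Finset.mem_filter, Finset.mem_univ, true_and, Finset.mem_powersetCard,
        Finset.subset_univ]
      omega
    rw [this, Finset.card_powersetCard, Finset.card_univ, Fintype.card_fin]
  rw [hsub]
  refine Finset.card_bij' (fun y _ => Finset.univ.filter fun i => x i ≠ y i)
    (fun s _ i => if i ∈ s then !(x i) else x i) ?_ ?_ ?_ ?_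
  · intro y hy
    simpa [hammingDist] using hy
  · intro s hs
    have : (Finset.univ.filter fun i => x i ≠ if i ∈ s then !(x i) else x i) = s := by
      ext i
      by_cases h : i ∈ s <;> simp [h]
    simpa [hammingDist, this] using hs
  · intro y hy
    funext i
    rcases hx : x i <;> rcases hy : y i <;> simp [hx, hy]
  · intro s hs
    ext i
    by_cases h : i ∈ s <;> simp [h]

theorem ballVol_pos (R n : ℕ) : 0 < ballVol R n :=
  Finset.sum_pos' (fun _ _ => Nat.zero_le _) ⟨0, by simp, by simp⟩

theorem ballVol_le_two_pow (R n : ℕ) : ballVol R n ≤ 2 ^ n := by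
  rw [← card_hammingBall R (fun _ => false)]
  exact (Finset.card_le_univ _).trans_eq (by simp)

/-- The points of the cube at distance more than `R` from `S`. -/
def uncovered {n : ℕ} (R : ℕ) (S : Finset (Vec n)) : Finset (Vec n) :=
  Finset.univ.filter fun u => ∀ s ∈ S, ¬ hammingDist u s ≤ R

theorem exists_ballVol_mul_le {n : ℕ} (R : ℕ) (U : Finset (Vec n)) :
    ∃ c : Vec n, (ballVol R n : ℝ) / 2 ^ n * U.card ≤
      (U.filter fun u => hammingDist u c ≤ R).card := by
  have hsum : ∑ c : Vec n, ((U.filter fun u => hammingDist u c ≤ R).card : ℝ) =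
      ∑ _c : Vec n, (ballVol R n : ℝ) / 2 ^ n * U.card := by
    have : ∑ c : Vec n, (U.filter fun u => hammingDist u c ≤ R).card = U.card * ballVol R n := by
      simp_rw [Finset.card_filter]
      rw [Finset.sum_comm]
      simp_rw [← Finset.card_filter, card_hammingBall]
      simp
    rw [← Nat.cast_sum, this]
    simp
    field_simp
  obtain ⟨c, -, hc⟩ := Finset.exists_le_of_sum_le Finset.univ_nonempty hsum.ge
  exact ⟨c, hc⟩

theorem exists_card_uncovered_le {n : ℕ} (R k : ℕ) :
    ∃ S : Finset (Vec n), S.card ≤ k ∧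
      ((uncovered R S).card : ℝ) ≤ 2 ^ n * (1 - (ballVol R n : ℝ) / 2 ^ n) ^ k := by
  have hq : (ballVol R n : ℝ) / 2 ^ n ≤ 1 := by
    rw [div_le_one (by positivity)]
    exact_mod_cast ballVol_le_two_pow R n
  induction k with
  | zero => exact ⟨∅, by simp, by simp [uncovered]⟩
  | succ k ih =>
    obtain ⟨S, hS, hU⟩ := ih
    obtain ⟨c, hc⟩ := exists_ballVol_mul_le R (uncovered R S)
    refine ⟨insert c S, (Finset.card_insert_le _ _).trans (by omega), ?_⟩
    have heq : uncovered R (insert c S) =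
        (uncovered R S).filter fun u => ¬ hammingDist u c ≤ R := by
      ext u
      simp [uncovered, and_comm]
    have hcard : (((uncovered R S).filter fun u => hammingDist u c ≤ R).card : ℝ) +
        (uncovered R (insert c S)).card = (uncovered R S).card := by
      rw [heq]
      exact_mod_cast Finset.card_filter_add_card_filter_not _
    have := mul_le_mul_of_nonneg_right hU (sub_nonneg.2 hq)
    rw [pow_succ]
    linarith

theorem exists_card_uncovered_le_exp (n R : ℕ) {c : ℝ} (hc : 0 ≤ c) :
    ∃ S : Finset (Vec n), (S.card : ℝ) ≤ c * 2 ^ n / ballVol R n + 1 ∧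
      ((uncovered R S).card : ℝ) ≤ 2 ^ n * Real.exp (-c) := by
  have hV : (0 : ℝ) < ballVol R n := by exact_mod_cast ballVol_pos R n
  obtain ⟨S, hS, hU⟩ := exists_card_uncovered_le (n := n) R ⌈c * 2 ^ n / ballVol R n⌉₊
  have hq : (ballVol R n : ℝ) / 2 ^ n ≤ 1 := by
    rw [div_le_one (by positivity)]
    exact_mod_cast ballVol_le_two_pow R n
  refine ⟨S, ?_, hU.trans ?_⟩
  · calc (S.card : ℝ) ≤ (⌈c * 2 ^ n / ballVol R n⌉₊ : ℝ) := by exact_mod_cast hS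
      _ ≤ _ := (Nat.ceil_lt_add_one (by positivity)).le
  · gcongr
    calc _ ≤ Real.exp (-((ballVol R n : ℝ) / 2 ^ n)) ^ ⌈c * 2 ^ n / ballVol R n⌉₊ :=
          pow_le_pow_left₀ (sub_nonneg.2 hq) (Real.one_sub_le_exp_neg _) _
      _ = Real.exp (-(⌈c * 2 ^ n / ballVol R n⌉₊ * ((ballVol R n : ℝ) / 2 ^ n))) := by
          rw [← Real.exp_nat_mul, mul_neg]
      _ ≤ Real.exp (-c) := by
          refine Real.exp_le_exp.2 (neg_le_neg ?_)
          calc c = c * 2 ^ n / ballVol R n * ((ballVol R n : ℝ) / 2 ^ n) := by field_simp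
            _ ≤ _ := by gcongr; exact Nat.le_ceil _

open Filter Topology

theorem nuDen_eq (n R : ℕ) : nuDen n R = Knu n R * (ballVol R n : ℝ) / 2 ^ n := by
  simp [nuDen, ballVol]

theorem nuDen_nonneg (n R : ℕ) : 0 ≤ nuDen n R := by
  rw [nuDen_eq]
  positivity

theorem ballVol_cast_pos (R n : ℕ) : (0 : ℝ) < ballVol R n := by
  exact_mod_cast ballVol_pos R n

theorem nuDen_add_le {m l : ℕ} (hl : 0 < l) (R : ℕ) {c : ℝ} (hc : 0 ≤ c) :
    nuDen (m + l) R ≤ c * ((ballVol R (m + l) : ℝ) / ballVol R m) +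
      (ballVol R (m + l) : ℝ) / 2 ^ m +
      Real.exp (-c) * nuDen l R * ((ballVol R (m + l) : ℝ) / ballVol R l) := by
  have hm := ballVol_cast_pos R m
  have hl' := ballVol_cast_pos R l
  obtain ⟨S, hS, hT⟩ := exists_card_uncovered_le_exp m R hc
  have hK : (Knu (m + l) R : ℝ) ≤
      (c * 2 ^ m / ballVol R m + 1) * 2 ^ l + 2 ^ m * Real.exp (-c) * Knu l R := by
    have : (Knu (m + l) R : ℝ) ≤ S.card * 2 ^ l + (uncovered R S).card * Knu l R := by
      exact_mod_cast Knu_add_le_of_patch hl R S (uncovered R S) fun u => by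
        by_contra! h
        exact h.1 (by simpa [uncovered] using h.2)
    refine this.trans ?_
    gcongr
  rw [nuDen_eq, nuDen_eq l]
  calc _ ≤ ((c * 2 ^ m / ballVol R m + 1) * 2 ^ l + 2 ^ m * Real.exp (-c) * Knu l R) *
        (ballVol R (m + l) : ℝ) / 2 ^ (m + l) := by gcongr
    _ = _ := by
      rw [pow_add]
      field_simp

theorem nuDen_add_le_mul {a b : ℕ} (ha : 0 < a) (hb : 0 < b) (R S : ℕ) :
    nuDen (a + b) (R + S) ≤ nuDen a R * nuDen b S *
      ((ballVol (R + S) (a + b) : ℝ) / (ballVol R a * ballVol S b)) := by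
  have hva := ballVol_cast_pos R a
  have hvb := ballVol_cast_pos S b
  have hK : (Knu (a + b) (R + S) : ℝ) ≤ Knu a R * Knu b S := by
    exact_mod_cast Knu_add_le_mul ha hb R S
  rw [nuDen_eq, nuDen_eq, nuDen_eq]
  calc _ ≤ (Knu a R * Knu b S : ℝ) * ballVol (R + S) (a + b) / 2 ^ (a + b) := by gcongr
    _ = _ := by
      rw [pow_add]
      field_simp

theorem tendsto_choose_div_pow (k : ℕ) :
    Tendsto (fun n : ℕ => (n.choose k : ℝ) / (n : ℝ) ^ k) atTop (𝓝 (1 / k.factorial)) := by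
  have h : Tendsto (fun n : ℕ => (n : ℝ) * (n : ℝ)⁻¹) atTop (𝓝 1) := by
    refine tendsto_const_nhds.congr' ?_
    filter_upwards [eventually_gt_atTop 0] with n hn
    have : (n : ℝ) ≠ 0 := by positivity
    field_simp
  simpa [div_eq_mul_inv] using ProbabilityTheory.tendsto_choose_mul_pow_atTop k h

theorem tendsto_ballVol_div_pow (R : ℕ) :
    Tendsto (fun n : ℕ => (ballVol R n : ℝ) / (n : ℝ) ^ R) atTop (𝓝 (1 / R.factorial)) := by
  induction R with
  | zero => simp [ballVol]
  | succ R ih =>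
    have h := (ih.mul (tendsto_inv_atTop_nhds_zero_nat (𝕜 := ℝ))).add
      (tendsto_choose_div_pow (R + 1))
    rw [mul_zero, zero_add] at h
    refine h.congr fun n => ?_
    have : ballVol (R + 1) n = ballVol R n + n.choose (R + 1) := Finset.sum_range_succ _ _
    rw [this]
    push_cast
    rw [pow_succ, add_div]
    congr 1
    rw [← div_eq_mul_inv, div_div]

section Proportional

variable {f : ℕ → ℕ} {α : ℝ}

theorem tendsto_atTop_of_tendsto_div (hα : 0 < α)
    (hf : Tendsto (fun n : ℕ => (f n : ℝ) / n) atTop (𝓝 α)) : Tendsto f atTop atTop := by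
  rw [← tendsto_natCast_atTop_iff (R := ℝ)]
  refine (hf.pos_mul_atTop hα tendsto_natCast_atTop_atTop).congr' ?_
  filter_upwards [eventually_gt_atTop 0] with n hn
  have : (n : ℝ) ≠ 0 := by positivity
  field_simp

theorem tendsto_ballVol_comp_div_pow (R : ℕ) (hα : 0 < α)
    (hf : Tendsto (fun n : ℕ => (f n : ℝ) / n) atTop (𝓝 α)) :
    Tendsto (fun n : ℕ => (ballVol R (f n) : ℝ) / (n : ℝ) ^ R) atTop
      (𝓝 (1 / R.factorial * α ^ R)) := by
  have hft := tendsto_atTop_of_tendsto_div hα hf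
  refine (((tendsto_ballVol_div_pow R).comp hft).mul (hf.pow R)).congr' ?_
  filter_upwards [hft.eventually_gt_atTop 0] with n hn
  have : (f n : ℝ) ≠ 0 := by positivity
  simp only [Function.comp_apply, div_pow]
  field_simp

theorem tendsto_ballVol_div_ballVol (R : ℕ) (hα : 0 < α)
    (hf : Tendsto (fun n : ℕ => (f n : ℝ) / n) atTop (𝓝 α)) :
    Tendsto (fun n : ℕ => (ballVol R n : ℝ) / ballVol R (f n)) atTop (𝓝 (α⁻¹ ^ R)) := by
  have hfac : (R.factorial : ℝ) ≠ 0 := by positivity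
  have h := (tendsto_ballVol_div_pow R).div (tendsto_ballVol_comp_div_pow R hα hf)
    (by positivity)
  have heq : 1 / (R.factorial : ℝ) / (1 / R.factorial * α ^ R) = α⁻¹ ^ R := by
    rw [inv_pow]
    field_simp
  rw [heq] at h
  refine h.congr' ?_
  filter_upwards [eventually_gt_atTop 0] with n hn
  have hn' : (n : ℝ) ≠ 0 := by positivity
  have := (ballVol_cast_pos R (f n)).ne'
  simp only [Pi.div_apply]
  field_simp

theorem tendsto_ballVol_div_two_pow (R : ℕ) (hα : 0 < α)
    (hf : Tendsto (fun n : ℕ => (f n : ℝ) / n) atTop (𝓝 α)) :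
    Tendsto (fun n : ℕ => (ballVol R n : ℝ) / 2 ^ f n) atTop (𝓝 0) := by
  have hft := tendsto_atTop_of_tendsto_div hα hf
  have h1 := (tendsto_ballVol_div_pow R).mul
    (tendsto_pow_const_div_const_pow_of_one_lt R (one_lt_two : (1 : ℝ) < 2))
  rw [mul_zero] at h1
  have h2 := (tendsto_ballVol_div_ballVol R hα hf).mul (h1.comp hft)
  rw [mul_zero] at h2
  refine h2.congr' ?_
  filter_upwards [hft.eventually_gt_atTop 0] with n hn
  have hn' : (f n : ℝ) ≠ 0 := by positivity
  have := (ballVol_cast_pos R (f n)).ne'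
  simp only [Function.comp_apply]
  field_simp

end Proportional

theorem tendsto_natDiv_div (k : ℕ) :
    Tendsto (fun n : ℕ => ((n / k : ℕ) : ℝ) / n) atTop (𝓝 (k : ℝ)⁻¹) := by
  refine ((tendsto_nat_floor_mul_div_atTop (R := ℝ) (a := (k : ℝ)⁻¹) (by positivity)).comp
    tendsto_natCast_atTop_atTop).congr fun n => ?_
  simp only [Function.comp_apply]
  rw [inv_mul_eq_div, Nat.floor_div_natCast, Nat.floor_natCast]

theorem tendsto_sub_natDiv_div (k : ℕ) :
    Tendsto (fun n : ℕ => ((n - n / k : ℕ) : ℝ) / n) atTop (𝓝 (1 - (k : ℝ)⁻¹)) := by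
  refine ((tendsto_const_nhds (x := (1 : ℝ))).sub (tendsto_natDiv_div k)).congr' ?_
  filter_upwards [eventually_gt_atTop 0] with n hn
  have : (n : ℝ) ≠ 0 := by positivity
  rw [Nat.cast_sub (Nat.div_le_self n k)]
  field_simp

theorem exists_eventually_nuDen_le_of_nuStar_ne_zero {R : ℕ} (h : nuStar R ≠ 0) :
    ∃ M, ∀ᶠ n in atTop, nuDen n R ≤ M := by
  by_contra! hM
  refine h ?_
  have : {a | ∀ᶠ n in atTop, nuDen n R ≤ a} = ∅ := by
    refine Set.eq_empty_iff_forall_notMem.2 fun a ha => ?_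
    obtain ⟨n, hn, hn'⟩ := (ha.and_frequently (hM a)).exists
    exact hn'.not_ge hn
  rw [nuStar, limsup_eq, this, Real.sInf_empty]

theorem exists_eventually_nuDen_succ_le {R : ℕ} (h1 : ∃ M, ∀ᶠ n in atTop, nuDen n 1 ≤ M)
    (hR : ∃ M, ∀ᶠ n in atTop, nuDen n R ≤ M) :
    ∃ M, ∀ᶠ n in atTop, nuDen n (R + 1) ≤ M := by
  obtain ⟨M₁, hM₁⟩ := h1
  obtain ⟨M, hM⟩ := hR
  have ha : Tendsto (fun n : ℕ => ((n - n / 2 : ℕ) : ℝ) / n) atTop (𝓝 (1 / 2)) := by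
    have := tendsto_sub_natDiv_div 2
    norm_num at this ⊢
    exact this
  have hb : Tendsto (fun n : ℕ => ((n / 2 : ℕ) : ℝ) / n) atTop (𝓝 (1 / 2)) := by
    simpa using tendsto_natDiv_div 2
  have hat := tendsto_atTop_of_tendsto_div one_half_pos ha
  have hbt := tendsto_atTop_of_tendsto_div one_half_pos hb
  have hvol := (tendsto_ballVol_div_pow (R + 1)).div
    ((tendsto_ballVol_comp_div_pow R one_half_pos ha).mul
      (tendsto_ballVol_comp_div_pow 1 one_half_pos hb)) (by positivity)
  obtain ⟨B, hB⟩ := hvol.isBoundedUnder_le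
  rw [eventually_map] at hB
  refine ⟨M * M₁ * B, ?_⟩
  filter_upwards [hB, hat.eventually hM, hbt.eventually hM₁, hat.eventually_gt_atTop 0,
    hbt.eventually_gt_atTop 0, eventually_gt_atTop 0] with n hn hMn hM₁n ha0 hb0 hn0
  have h := nuDen_add_le_mul ha0 hb0 R 1
  rw [Nat.sub_add_cancel (Nat.div_le_self n 2)] at h
  have hn' : (n : ℝ) ≠ 0 := by positivity
  have hva := ballVol_cast_pos R (n - n / 2)
  have hvb := ballVol_cast_pos 1 (n / 2)
  have hle : (ballVol (R + 1) n : ℝ) / (ballVol R (n - n / 2) * ballVol 1 (n / 2)) ≤ B := by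
    refine le_of_eq_of_le ?_ hn
    simp only [Pi.div_apply]
    rw [pow_succ]
    field_simp
  have h0 := nuDen_nonneg (n - n / 2) R
  have h0' := nuDen_nonneg (n / 2) 1
  have hM0 := h0.trans hMn
  refine h.trans ?_
  gcongr
  exact mul_nonneg hM0 (h0'.trans hM₁n)

theorem exists_eventually_nuDen_le (h1 : ∃ M, ∀ᶠ n in atTop, nuDen n 1 ≤ M) {R : ℕ}
    (hR : 1 ≤ R) : ∃ M, ∀ᶠ n in atTop, nuDen n R ≤ M := by
  induction R, hR using Nat.le_induction with
  | base => exact h1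
  | succ R _ ih => exact exists_eventually_nuDen_succ_le h1 ih

theorem nuStar_le_of_eventually_nuDen_le {R : ℕ} (hR : 1 ≤ R) {c M : ℝ} (hc : 0 ≤ c)
    (hM : ∀ᶠ n in atTop, nuDen n R ≤ M) :
    nuStar R ≤ c * (1 + 1 / (R : ℝ)) ^ R + Real.exp (-c) * M * ((R : ℝ) + 1) ^ R := by
  have hR0 : (0 : ℝ) < R := by exact_mod_cast hR
  have hl : Tendsto (fun n : ℕ => ((n / (R + 1) : ℕ) : ℝ) / n) atTop (𝓝 ((R : ℝ) + 1)⁻¹) := by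
    exact_mod_cast tendsto_natDiv_div (R + 1)
  have hm : Tendsto (fun n : ℕ => ((n - n / (R + 1) : ℕ) : ℝ) / n) atTop
      (𝓝 (1 + 1 / (R : ℝ))⁻¹) := by
    have heq : (1 + 1 / (R : ℝ))⁻¹ = 1 - ((R + 1 : ℕ) : ℝ)⁻¹ := by
      push_cast
      field_simp
      ring
    rw [heq]
    exact tendsto_sub_natDiv_div (R + 1)
  have hl0 : 0 < ((R : ℝ) + 1)⁻¹ := by positivity
  have hm0 : 0 < (1 + 1 / (R : ℝ))⁻¹ := by positivity
  have hlt := tendsto_atTop_of_tendsto_div hl0 hl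
  have hlim := (((tendsto_ballVol_div_ballVol R hm0 hm).const_mul c).add
    (tendsto_ballVol_div_two_pow R hm0 hm)).add
    ((tendsto_ballVol_div_ballVol R hl0 hl).const_mul (Real.exp (-c) * M))
  rw [inv_inv, inv_inv, add_zero] at hlim
  refine le_of_forall_gt_imp_ge_of_dense fun B hB => ?_
  have hbdd : IsBoundedUnder (· ≥ ·) atTop (fun n => nuDen n R) :=
    isBoundedUnder_of ⟨0, fun n => nuDen_nonneg n R⟩
  refine limsup_le_of_le hbdd.isCoboundedUnder_le ?_
  filter_upwards [hlim.eventually_lt_const hB, hlt.eventually hM, hlt.eventually_gt_atTop 0]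
    with n hn hMn hn0
  have h := nuDen_add_le (m := n - n / (R + 1)) hn0 R hc
  rw [Nat.sub_add_cancel (Nat.div_le_self n (R + 1))] at h
  refine (h.trans ?_).trans hn.le
  gcongr

theorem nuStar_le_recursion {R : ℕ} (hR : 1 ≤ R) (hb : ∃ M, ∀ᶠ n in atTop, nuDen n R ≤ M)
    {c : ℝ} (hc : 0 ≤ c) :
    nuStar R ≤ c * (1 + 1 / (R : ℝ)) ^ R + Real.exp (-c) * nuStar R * ((R : ℝ) + 1) ^ R := by
  obtain ⟨M, hM⟩ := hb
  have hbdd : IsBoundedUnder (· ≤ ·) atTop (fun n => nuDen n R) := ⟨M, by simpa using hM⟩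
  have hcont : Tendsto (fun x : ℝ => c * (1 + 1 / (R : ℝ)) ^ R +
      Real.exp (-c) * x * ((R : ℝ) + 1) ^ R) (𝓝[>] (nuStar R))
      (𝓝 (c * (1 + 1 / (R : ℝ)) ^ R + Real.exp (-c) * nuStar R * ((R : ℝ) + 1) ^ R)) :=
    (Continuous.tendsto (by fun_prop) _).mono_left nhdsWithin_le_nhds
  refine ge_of_tendsto hcont ?_
  filter_upwards [self_mem_nhdsWithin] with x hx
  exact nuStar_le_of_eventually_nuDen_le hR hc
    ((eventually_lt_of_limsup_lt hx hbdd).mono fun _ => le_of_lt)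

theorem nuStar_le_exp_one_mul {R : ℕ} (hR : 1 ≤ R) (hb : ∃ M, ∀ᶠ n in atTop, nuDen n R ≤ M)
    {t : ℝ} (ht : 0 < t) :
    nuStar R ≤ Real.exp 1 * ((R * Real.log (R + 1) + Real.log (t + 1)) * (1 + 1 / t)) := by
  have hR0 : (0 : ℝ) < R := by exact_mod_cast hR
  set c := R * Real.log (R + 1) + Real.log (t + 1) with hc
  have hc0 : 0 ≤ c := by
    have h1 : 0 ≤ Real.log ((R : ℝ) + 1) := Real.log_nonneg (by linarith)
    have h2 : 0 ≤ Real.log (t + 1) := Real.log_nonneg (by linarith)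
    positivity
  have hexp : Real.exp (-c) * ((R : ℝ) + 1) ^ R = (t + 1)⁻¹ := by
    rw [Real.exp_neg, hc, Real.exp_add, Real.exp_nat_mul, Real.exp_log (by positivity),
      Real.exp_log (by positivity)]
    field_simp
  have hpow : (1 + 1 / (R : ℝ)) ^ R ≤ Real.exp 1 := by
    calc _ ≤ Real.exp (1 / R) ^ R := by
          gcongr
          linarith [Real.add_one_le_exp (1 / (R : ℝ))]
      _ = Real.exp 1 := by
          rw [← Real.exp_nat_mul]
          field_simp
  have h := nuStar_le_recursion hR hb hc0
  rw [mul_right_comm, hexp] at h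
  have h' : nuStar R ≤ c * Real.exp 1 + (t + 1)⁻¹ * nuStar R :=
    h.trans (by gcongr)
  have heq : (t + 1)⁻¹ * nuStar R = nuStar R - t / (t + 1) * nuStar R := by
    field_simp
    ring
  rw [heq] at h'
  have h'' : t / (t + 1) * nuStar R ≤ c * Real.exp 1 := by linarith
  calc nuStar R = (t / (t + 1) * nuStar R) * (1 + 1 / t) := by field_simp
    _ ≤ (c * Real.exp 1) * (1 + 1 / t) := by gcongr
    _ = _ := by ring

theorem covering_exponent_le {R : ℝ} (hR : 2 ≤ R) :
    (R * Real.log (R + 1) + Real.log (2 * (R * Real.log R) + 1)) *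
      (1 + 1 / (2 * (R * Real.log R))) ≤
      R * Real.log R + Real.log R + Real.log (Real.log R) + 4 := by
  have hlog2 := Real.log_two_gt_d9
  have hlog2' := Real.log_two_lt_d9
  have hlogR : Real.log 2 ≤ Real.log R := Real.log_le_log (by norm_num) hR
  have hlog0 : 0 < Real.log R := by linarith
  have hlogu : Real.log (R * Real.log R) = Real.log R + Real.log (Real.log R) :=
    Real.log_mul (by positivity) hlog0.ne'
  have hu : 1.386 ≤ R * Real.log R := by nlinarith
  have h1 : R * Real.log (R + 1) ≤ R * Real.log R + 1 := by
    have h : Real.log (R + 1) - Real.log R ≤ 1 / R := by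
      rw [← Real.log_div (by positivity) (by positivity)]
      refine (Real.log_le_sub_one_of_pos (by positivity)).trans_eq ?_
      field_simp
      ring
    have := mul_le_mul_of_nonneg_left h (by positivity : 0 ≤ R)
    have hRR : R * (1 / R) = 1 := by field_simp
    linarith
  set u := R * Real.log R with hu_def
  have hu0 : 0 < u := by linarith
  have h2 : Real.log (2 * u + 1) ≤ Real.log 2 + Real.log u + 1 / (2 * u) := by
    have h : Real.log (2 * u + 1) - Real.log (2 * u) ≤ 1 / (2 * u) := by
      rw [← Real.log_div (by positivity) (by positivity)]
      refine (Real.log_le_sub_one_of_pos (by positivity)).trans_eq ?_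
      field_simp
      ring
    rw [Real.log_mul (by norm_num) hu0.ne'] at h
    linarith
  have h3 : Real.log u ≤ u - 1 := Real.log_le_sub_one_of_pos hu0
  have hv : 1 / (2 * u) ≤ 0.361 := by
    rw [div_le_iff₀ (by positivity)]
    linarith
  have hv0 : 0 < 1 / (2 * u) := by positivity
  have huv : u * (1 / (2 * u)) = 1 / 2 := by field_simp
  set v := 1 / (2 * u) with hv_def
  have hle : R * Real.log (R + 1) + Real.log (2 * u + 1) ≤
      u + 1 + Real.log 2 + Real.log u + v := by linarith
  have hle' : R * Real.log (R + 1) + Real.log (2 * u + 1) ≤ 2 * u + Real.log 2 + v := by linarith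
  have hmul := mul_le_mul_of_nonneg_right hle' hv0.le
  have hvv : v * v ≤ 0.361 * 0.361 := by gcongr
  have hlv : Real.log 2 * v ≤ 0.7 * 0.361 := by gcongr; linarith
  nlinarith

theorem nuStar_bound (R : ℕ) (hR : 2 ≤ R) (h1 : nuStar 1 = 1) :
    nuStar R ≤ Real.exp 1 *
      ((R : ℝ) * Real.log R + Real.log R + Real.log (Real.log R) + 4) := by
  have hb := exists_eventually_nuDen_le
    (exists_eventually_nuDen_le_of_nuStar_ne_zero (R := 1) (by simp [h1])) (by omega : 1 ≤ R)
  have hR' : (2 : ℝ) ≤ R := by exact_mod_cast hR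
  have hlog : 0 < Real.log R := Real.log_pos (by linarith)
  refine (nuStar_le_exp_one_mul (by omega) hb (t := 2 * (R * Real.log R)) (by positivity)).trans ?_
  gcongr
  exact covering_exponent_le hR'
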